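/- Let n ≥ 2, let μ ∈ (0,1], and let m be a nonnegative integer with m ≠ 2. Let F : Sym_n(ℝ) → ℝ be continuously differentiable and uniformly elliptic, in the sense that for every symmetric matrix M and every symmetric positive semidefinite matrix P one has μ·tr(P) ≤ DF(M)(P) ≤ μ⁻¹·tr(P). Suppose u : ℝⁿ → ℝ is twice continuously differentiable on ℝⁿ \ {0}, positively homogeneous of degree m, and satisfies F(D²u(x)) = 0 for all x ≠ 0. Then there exists a polynomial function p : ℝⁿ → ℝ, homogeneous of degree m, such that u(x) = p(x) for all x ≠ 0 and ∑_{i,j=1}^{n} F_{ij}(0)·D_{ij}p(x) = 0 for all x, where F_{ij}(0) denotes the partial derivative of F with respect to the (i,j) matrix entry evaluated at the zero matrix. -/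

import Mathlib

attribute [local instance] Matrix.normedAddCommGroup Matrix.normedSpace

/-- The Hessian matrix of second partial derivatives of `u : ℝⁿ → ℝ`. -/
noncomputable def hessian {n : ℕ} (u : EuclideanSpace ℝ (Fin n) → ℝ)
    (x : EuclideanSpace ℝ (Fin n)) : Matrix (Fin n) (Fin n) ℝ :=
  Matrix.of fun i j =>
    fderiv ℝ (fun y => fderiv ℝ u y (EuclideanSpace.single j (1 : ℝ))) x
      (EuclideanSpace.single i (1 : ℝ))

section BasisLaplacian

open MeasureTheory Module
open scoped ContDiff Topology

variable {E : Type*} [NormedAddCommGroup E] [NormedSpace ℝ E]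
  {ι : Type*}

lemma contDiff_coord [FiniteDimensional ℝ E] (b : Basis ι ℝ E) (k : ι) {n : ℕ∞ω} :
    ContDiff ℝ n (fun x => b.coord k x) :=
  (b.coord k).toContinuousLinearMap.contDiff

variable [Fintype ι]

/-- The constant-coefficient operator `∑ₖ ∂_{bₖ}²` attached to a basis `b`. -/
noncomputable def basisLaplacian (b : Basis ι ℝ E) (f : E → ℝ) (x : E) : ℝ :=
  ∑ k, fderiv ℝ (fun y => fderiv ℝ f y (b k)) x (b k)

/-- The sum of the squares of the coordinates in a basis `b`. -/
noncomputable def basisSq (b : Basis ι ℝ E) (x : E) : ℝ := ∑ k, (b.coord k x) ^ 2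

lemma basisSq_nonneg (b : Basis ι ℝ E) (x : E) : 0 ≤ basisSq b x :=
  Finset.sum_nonneg fun _ _ => sq_nonneg _

@[simp] lemma basisSq_zero (b : Basis ι ℝ E) : basisSq b 0 = 0 := by simp [basisSq]

lemma basisSq_smul (b : Basis ι ℝ E) (t : ℝ) (x : E) :
    basisSq b (t • x) = t ^ 2 * basisSq b x := by
  simp [basisSq, mul_pow, Finset.mul_sum]

lemma fderiv_eq_sum_coord (b : Basis ι ℝ E) (f : E → ℝ) (x v : E) :
    fderiv ℝ f x v = ∑ k, b.coord k v * fderiv ℝ f x (b k) := by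
  calc fderiv ℝ f x v = fderiv ℝ f x (∑ k, b.repr v k • b k) := by rw [b.sum_repr]
    _ = _ := by simp only [map_sum, map_smul, smul_eq_mul, Basis.coord_apply]

lemma ContDiffAt.fderiv_apply_const {f : E → ℝ} {x : E} {m n : ℕ∞ω} (h : ContDiffAt ℝ n f x)
    (hmn : m + 1 ≤ n) (v : E) : ContDiffAt ℝ m (fun y => fderiv ℝ f y v) x :=
  (h.fderiv_right hmn).clm_apply contDiffAt_const

lemma fderiv_smul_of_homogeneous {f : E → ℝ} {a : ℝ}
    (h : ∀ t : ℝ, 0 < t → ∀ x : E, x ≠ 0 → f (t • x) = t ^ a * f x) (v : E) :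
    ∀ t : ℝ, 0 < t → ∀ x : E, x ≠ 0 →
      fderiv ℝ f (t • x) v = t ^ (a - 1) * fderiv ℝ f x v := by
  intro t ht x hx
  have he : (fun y => f (t • y)) =ᶠ[𝓝 x] t ^ a • f := by
    filter_upwards [isOpen_compl_singleton.mem_nhds hx] with y hy
    simpa using h t ht y hy
  have h1 := DFunLike.congr_fun (he.fderiv_eq (𝕜 := ℝ)) v
  rw [fderiv_comp_smul, fderiv_const_smul_field] at h1
  simp only [smul_apply, smul_eq_mul, Pi.smul_apply] at h1
  rw [Real.rpow_sub_one ht.ne', div_mul_eq_mul_div, eq_div_iff ht.ne', ← h1, mul_comm]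

lemma fderiv_self_of_homogeneous {f : E → ℝ} {a : ℝ}
    (h : ∀ t : ℝ, 0 < t → ∀ x : E, x ≠ 0 → f (t • x) = t ^ a * f x) {x : E} (hx : x ≠ 0)
    (hf : DifferentiableAt ℝ f x) : fderiv ℝ f x x = a * f x := by
  have h1 : HasDerivAt (fun t : ℝ => f (t • x)) (fderiv ℝ f x x) 1 := by
    have hs : HasDerivAt (fun t : ℝ => t • x) x 1 := by
      simpa using (hasDerivAt_id (1 : ℝ)).smul_const x
    have hf' : HasFDerivAt f (fderiv ℝ f x) ((1 : ℝ) • x) := by simpa using hf.hasFDerivAt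
    exact hf'.comp_hasDerivAt (1 : ℝ) hs
  have h2 : HasDerivAt (fun t : ℝ => t ^ a * f x) (a * f x) 1 := by
    simpa using (Real.hasDerivAt_rpow_const (x := 1) (p := a) (by simp)).mul_const (f x)
  refine h1.unique (h2.congr_of_eventuallyEq ?_)
  filter_upwards [lt_mem_nhds (one_pos (α := ℝ))] with t ht
  exact h t ht x hx

lemma fderiv_fderiv_comm {f : E → ℝ} {x : E} (h : ContDiffAt ℝ 2 f x) (v w : E) :
    fderiv ℝ (fun y => fderiv ℝ f y v) x w = fderiv ℝ (fun y => fderiv ℝ f y w) x v := by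
  have hd : DifferentiableAt ℝ (fderiv ℝ f) x :=
    (h.fderiv_right (m := 1) (by norm_num)).differentiableAt one_ne_zero
  rw [fderiv_clm_apply hd (differentiableAt_const _), fderiv_clm_apply hd (differentiableAt_const _)]
  simpa using h.isSymmSndFDerivAt (by simp) w v

lemma basisLaplacian_congr (b : Basis ι ℝ E) {f g : E → ℝ} {x : E} (h : f =ᶠ[𝓝 x] g) :
    basisLaplacian b f x = basisLaplacian b g x := by
  refine Finset.sum_congr rfl fun k _ => ?_
  have : (fun y => fderiv ℝ f y (b k)) =ᶠ[𝓝 x] fun y => fderiv ℝ g y (b k) := by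
    filter_upwards [h.fderiv (𝕜 := ℝ)] with y hy
    rw [hy]
  rw [this.fderiv_eq]

lemma basisLaplacian_fderiv (b : Basis ι ℝ E) {f : E → ℝ} {x : E} (h : ContDiffAt ℝ 3 f x)
    (v : E) :
    basisLaplacian b (fun y => fderiv ℝ f y v) x = fderiv ℝ (basisLaplacian b f) x v := by
  have h2 : ∀ᶠ y in 𝓝 x, ContDiffAt ℝ 2 f y :=
    (h.eventually (by simp)).mono fun y hy => hy.of_le (by norm_num)
  have hd : ∀ k, ContDiffAt ℝ 2 (fun y => fderiv ℝ f y (b k)) x := fun k =>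
    h.fderiv_apply_const (by norm_num) _
  have hdd : ∀ k, DifferentiableAt ℝ
      (fun y => fderiv ℝ (fun z => fderiv ℝ f z (b k)) y (b k)) x := fun k =>
    ((hd k).fderiv_apply_const (m := 1) (by norm_num) _).differentiableAt one_ne_zero
  have : basisLaplacian b f =
    fun y => ∑ k, fderiv ℝ (fun z => fderiv ℝ f z (b k)) y (b k) := rfl
  rw [this, fderiv_fun_sum fun k _ => hdd k, sum_apply]
  refine Finset.sum_congr rfl fun k _ => ?_
  have hc : (fun y => fderiv ℝ (fun z => fderiv ℝ f z v) y (b k)) =ᶠ[𝓝 x]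
      fun y => fderiv ℝ (fun z => fderiv ℝ f z (b k)) y v :=
    h2.mono fun y hy => fderiv_fderiv_comm hy _ _
  rw [hc.fderiv_eq, fderiv_fderiv_comm (hd k)]

lemma exists_norm_sq_le_basisSq (b : Basis ι ℝ E) :
    ∃ C : ℝ, 0 < C ∧ ∀ x, ‖x‖ ^ 2 ≤ C * basisSq b x := by
  obtain ⟨C, hC, h⟩ := (b.equivFunL.symm : (ι → ℝ) →L[ℝ] E).bound
  refine ⟨C ^ 2, by positivity, fun x => ?_⟩
  have h1 := h (b.equivFunL x)
  simp only [ContinuousLinearEquiv.coe_coe, ContinuousLinearEquiv.symm_apply_apply] at h1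
  have h2 : ‖b.equivFunL x‖ ≤ Real.sqrt (basisSq b x) := by
    refine (pi_norm_le_iff_of_nonneg (Real.sqrt_nonneg _)).2 fun k => ?_
    refine Real.le_sqrt_of_sq_le ?_
    rw [Real.norm_eq_abs, sq_abs]
    exact Finset.single_le_sum (f := fun k => (b.coord k x) ^ 2)
      (fun _ _ => sq_nonneg _) (Finset.mem_univ k)
  calc ‖x‖ ^ 2 ≤ (C * Real.sqrt (basisSq b x)) ^ 2 := by gcongr; exact h1.trans (by gcongr)
    _ = C ^ 2 * basisSq b x := by rw [mul_pow, Real.sq_sqrt (basisSq_nonneg b x)]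

variable [FiniteDimensional ℝ E]

lemma contDiff_basisSq (b : Basis ι ℝ E) {n : ℕ∞ω} : ContDiff ℝ n (basisSq b) :=
  ContDiff.sum fun k _ => (contDiff_coord b k).pow 2

lemma fderiv_basisSq (b : Basis ι ℝ E) (x : E) (k : ι) :
    fderiv ℝ (basisSq b) x (b k) = 2 * b.coord k x := by
  classical
  have h : HasFDerivAt (basisSq b)
      (∑ j, (2 * b.coord j x) • (b.coord j).toContinuousLinearMap) x := by
    refine HasFDerivAt.fun_sum fun j _ => ?_
    simpa using ((b.coord j).toContinuousLinearMap.hasFDerivAt (x := x)).pow 2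
  rw [h.fderiv]
  simp [Finsupp.single_apply]

lemma fderiv_comp_basisSq (b : Basis ι ℝ E) {G : ℝ → ℝ} {G' : ℝ} {x : E}
    (hG : HasDerivAt G G' (basisSq b x)) (k : ι) :
    fderiv ℝ (fun y => G (basisSq b y)) x (b k) = G' * (2 * b.coord k x) := by
  have h := hG.comp_hasFDerivAt x
    ((contDiff_basisSq b (n := 1)).differentiable one_ne_zero x).hasFDerivAt
  have h' := h.fderiv
  simp only [Function.comp_def] at h'
  rw [h', smul_apply, fderiv_basisSq, smul_eq_mul]

lemma hasCompactSupport_comp_basisSq (b : Basis ι ℝ E) {G : ℝ → ℝ} {s : ℝ}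
    (hG : ∀ t, s ≤ t → G t = 0) : HasCompactSupport fun x => G (basisSq b x) := by
  obtain ⟨C, hC, h⟩ := exists_norm_sq_le_basisSq b
  refine HasCompactSupport.of_support_subset_isCompact
    (isCompact_closedBall (0 : E) (Real.sqrt (C * s))) fun x hx => ?_
  have : basisSq b x < s := lt_of_not_ge fun h' => hx (hG _ h')
  rw [mem_closedBall_zero_iff]
  exact Real.le_sqrt_of_sq_le ((h x).trans (by gcongr))

lemma exists_basisSq_kernel (b : Basis ι ℝ E) {r : ℝ} (hr : 0 < r) :
    ∃ φ Ψ : E → ℝ, ContDiff ℝ ∞ φ ∧ HasCompactSupport φ ∧ 0 ≤ φ ∧ φ 0 ≠ 0 ∧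
      ContDiff ℝ 1 Ψ ∧ HasCompactSupport Ψ ∧ (∀ y, Ψ y ≠ 0 → ‖y‖ < r) ∧
      ∀ y k, fderiv ℝ Ψ y (b k) = φ y * b.coord k y := by
  obtain ⟨C, hC, hCq⟩ := exists_norm_sq_le_basisSq b
  set s := r ^ 2 / C with hs
  have hs0 : 0 < s := by positivity
  let g : ContDiffBump (0 : ℝ) := ⟨s / 2, s, by positivity, by linarith⟩
  have hg0 : ∀ t, s ≤ t → g t = 0 := fun t ht =>
    g.zero_of_le_dist (by simpa [g, Real.dist_eq] using ht.trans (le_abs_self t))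
  let G : ℝ → ℝ := fun t => ∫ τ in s..t, g τ
  have hG : ∀ t, HasDerivAt G (g t) t := fun t =>
    intervalIntegral.integral_hasDerivAt_right (g.continuous.intervalIntegrable _ _)
      (g.continuous.stronglyMeasurableAtFilter _ _) g.continuous.continuousAt
  have hGc : ContDiff ℝ 1 G := by
    rw [contDiff_one_iff_deriv]
    refine ⟨fun t => (hG t).differentiableAt, ?_⟩
    rw [show deriv G = g from funext fun t => (hG t).deriv]
    exact g.continuous
  have hG0 : ∀ t, s ≤ t → G t = 0 := fun t ht => by
    simp only [G]
    rw [intervalIntegral.integral_congr (g := fun _ => 0)]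
    · simp
    · intro τ hτ
      rw [Set.uIcc_of_le ht] at hτ
      exact hg0 τ hτ.1
  refine ⟨fun y => 2 * g (basisSq b y), fun y => G (basisSq b y),
    contDiff_const.mul (g.contDiff.comp (contDiff_basisSq b)),
    (hasCompactSupport_comp_basisSq b hg0).mul_left,
    fun y => mul_nonneg two_pos.le g.nonneg, ?_, hGc.comp (contDiff_basisSq b),
    hasCompactSupport_comp_basisSq b hG0, fun y hy => ?_, fun y k => ?_⟩
  · have : g 0 = 1 := g.one_of_mem_closedBall (by simp [g.rIn_pos.le])
    simp [this]
  · have h1 : basisSq b y < s := lt_of_not_ge fun h => hy (hG0 _ h)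
    refine lt_of_pow_lt_pow_left₀ 2 hr.le ((hCq y).trans_lt ?_)
    rw [hs, lt_div_iff₀ hC] at h1
    linarith
  · rw [fderiv_comp_basisSq b (hG _)]
    ring

variable [MeasurableSpace E] [BorelSpace E] {ν : Measure E} [ν.IsAddHaarMeasure]

lemma integral_fderiv_eq_zero {f : E → ℝ} (hf : ContDiff ℝ 1 f) (hc : HasCompactSupport f)
    (v : E) : ∫ x, fderiv ℝ f x v ∂ν = 0 := by
  have hi : Integrable f ν := hf.continuous.integrable_of_hasCompactSupport hc
  have hi' : Integrable (fun x => fderiv ℝ f x v) ν :=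
    ((hf.continuous_fderiv one_ne_zero).clm_apply continuous_const).integrable_of_hasCompactSupport
      (hc.fderiv_apply ℝ v)
  have := integral_mul_fderiv_eq_neg_fderiv_mul_of_integrable (μ := ν) (f := fun _ : E => (1 : ℝ))
    (g := f) (v := v) (by simp) (by simpa using hi') (by simpa using hi)
    (fun x _ => differentiableAt_const _) (fun x _ => hf.differentiable one_ne_zero x)
  simpa using this

lemma integral_fderiv_mul_eq {f g : E → ℝ} (hf : ContDiff ℝ 1 f) (hc : HasCompactSupport f)
    (hg : ContDiff ℝ 1 g) (v : E) :
    ∫ x, fderiv ℝ f x v * g x ∂ν = - ∫ x, f x * fderiv ℝ g x v ∂ν := by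
  have hf' : Continuous fun x => fderiv ℝ f x v :=
    (hf.continuous_fderiv one_ne_zero).clm_apply continuous_const
  have hg' : Continuous fun x => fderiv ℝ g x v :=
    (hg.continuous_fderiv one_ne_zero).clm_apply continuous_const
  rw [integral_mul_fderiv_eq_neg_fderiv_mul_of_integrable, neg_neg]
  · exact (hf'.mul hg.continuous).integrable_of_hasCompactSupport (hc.fderiv_apply ℝ v).mul_right
  · exact (hf.continuous.mul hg').integrable_of_hasCompactSupport hc.mul_right
  · exact (hf.continuous.mul hg.continuous).integrable_of_hasCompactSupport hc.mul_right
  · exact fun x _ => hf.differentiable one_ne_zero x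
  · exact fun x _ => hg.differentiable one_ne_zero x

/-- Mean value property: a function annihilated by `basisLaplacian b` near `x` is reproduced, up to
a factor, by convolution with a kernel `φ` that is radial for `basisSq b`. -/
lemma integral_mul_comp_sub_eq (b : Basis ι ℝ E) {w φ Ψ : E → ℝ} (hw : ContDiff ℝ 2 w)
    (hwc : HasCompactSupport w) (hφ : Continuous φ) (hφc : HasCompactSupport φ)
    (hΨ : ContDiff ℝ 1 Ψ) (hΨc : HasCompactSupport Ψ)
    (hΨφ : ∀ y k, fderiv ℝ Ψ y (b k) = φ y * b.coord k y) (x : E)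
    (hx : ∀ y, Ψ y ≠ 0 → ∀ t ∈ Set.Icc (0 : ℝ) 1, basisLaplacian b w (x - t • y) = 0) :
    ∫ y, φ y * w (x - y) ∂ν = (∫ y, φ y ∂ν) * w x := by
  have hw' : Continuous (fderiv ℝ w) := hw.continuous_fderiv two_ne_zero
  have hDw : ∀ v, ContDiff ℝ 1 fun z => fderiv ℝ w z v := fun v =>
    (hw.fderiv_right (m := 1) (by norm_num)).clm_apply contDiff_const
  obtain ⟨C, hC⟩ := hw'.bounded_above_of_compact_support (hwc.fderiv (𝕜 := ℝ))
  let I : ℝ → ℝ := fun t => ∫ y, φ y * w (x - t • y) ∂ν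
  have hI : ∀ t, HasDerivAt I (∫ y, φ y * fderiv ℝ w (x - t • y) (-y) ∂ν) t := by
    intro t
    refine (hasDerivAt_integral_of_dominated_loc_of_deriv_le (μ := ν) (s := Set.univ) (x₀ := t)
      (F := fun s y => φ y * w (x - s • y)) (F' := fun s y => φ y * fderiv ℝ w (x - s • y) (-y))
      (bound := fun y => ‖φ y‖ * (C * ‖y‖)) Filter.univ_mem ?_ ?_ ?_ ?_ ?_ ?_).2
    · exact .of_forall fun s => (hφ.mul (hw.continuous.comp (by fun_prop))).aestronglyMeasurable
    · exact (hφ.mul (hw.continuous.comp (by fun_prop))).integrable_of_hasCompactSupport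
        hφc.mul_right
    · exact (hφ.mul ((hw'.comp (by fun_prop)).clm_apply
        (by fun_prop))).aestronglyMeasurable
    · refine .of_forall fun y s _ => ?_
      rw [norm_mul]
      gcongr
      refine (ContinuousLinearMap.le_opNorm _ _).trans ?_
      rw [norm_neg]
      gcongr
      exact hC _
    · exact (hφ.norm.mul (by fun_prop)).integrable_of_hasCompactSupport hφc.norm.mul_right
    · refine .of_forall fun y s _ => ?_
      have h1 : HasDerivAt (fun s : ℝ => x - s • y) (-y) s := by
        simpa using ((hasDerivAt_id s).smul_const y).const_sub x
      exact ((hw.differentiable two_ne_zero _).hasFDerivAt.comp_hasDerivAt s h1).const_mul _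
  have hI0 : ∀ t ∈ Set.Icc (0 : ℝ) 1, ∫ y, φ y * fderiv ℝ w (x - t • y) (-y) ∂ν = 0 := by
    intro t ht
    have hsub : ContDiff ℝ 1 fun y : E => x - t • y := by fun_prop
    have hterm : ∀ k, ∫ y, fderiv ℝ Ψ y (b k) * fderiv ℝ w (x - t • y) (b k) ∂ν =
        t * ∫ y, Ψ y * fderiv ℝ (fun z => fderiv ℝ w z (b k)) (x - t • y) (b k) ∂ν := by
      intro k
      rw [integral_fderiv_mul_eq (g := fun y => fderiv ℝ w (x - t • y) (b k)) hΨ hΨc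
          ((hDw (b k)).comp hsub), ← integral_neg,
        ← integral_const_mul]
      refine integral_congr_ae (.of_forall fun y => ?_)
      have h1 : HasFDerivAt (fun y : E => x - t • y) (-(t • ContinuousLinearMap.id ℝ E)) y := by
        simpa using ((hasFDerivAt_id y).const_smul t).const_sub x
      have h2 : fderiv ℝ (fun y => fderiv ℝ w (x - t • y) (b k)) y (b k) =
          -(t * fderiv ℝ (fun z => fderiv ℝ w z (b k)) (x - t • y) (b k)) := by
        refine (DFunLike.congr_fun (((hDw (b k)).differentiable one_ne_zero
          (x - t • y)).hasFDerivAt.comp y h1).fderiv (b k)).trans ?_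
        simp
      simp only [h2]
      ring
    calc ∫ y, φ y * fderiv ℝ w (x - t • y) (-y) ∂ν
        = ∫ y, -∑ k, fderiv ℝ Ψ y (b k) * fderiv ℝ w (x - t • y) (b k) ∂ν := by
          refine integral_congr_ae (.of_forall fun y => ?_)
          simp only [map_neg, fderiv_eq_sum_coord b w _ y, hΨφ, mul_neg, Finset.mul_sum, mul_assoc]
      _ = -(t * ∫ y, Ψ y * basisLaplacian b w (x - t • y) ∂ν) := by
          rw [integral_neg, integral_finsetSum, Finset.sum_congr rfl fun k _ => hterm k,
            ← Finset.mul_sum, ← integral_finsetSum]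
          · simp only [basisLaplacian, Finset.mul_sum]
          · intro k _
            exact (hΨ.continuous.mul ((((hDw (b k)).continuous_fderiv one_ne_zero).comp
              hsub.continuous).clm_apply continuous_const)).integrable_of_hasCompactSupport
              hΨc.mul_right
          · intro k _
            exact (((hΨ.continuous_fderiv one_ne_zero).clm_apply continuous_const).mul
              ((hDw (b k)).continuous.comp hsub.continuous)).integrable_of_hasCompactSupport
              (hΨc.fderiv_apply ℝ (b k)).mul_right
      _ = 0 := by
          have : ∀ y, Ψ y * basisLaplacian b w (x - t • y) = 0 := fun y => by
            by_cases h : Ψ y = 0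
            · simp [h]
            · simp [hx y h t ht]
          simp [this]
  have hconst := constant_of_has_deriv_right_zero (f := I) (a := 0) (b := 1)
    (fun t _ => (hI t).continuousAt.continuousWithinAt)
    (fun t ht => by
      have := (hI t).hasDerivWithinAt (s := Set.Ici t)
      rwa [hI0 t ⟨ht.1, ht.2.le⟩] at this) 1 (by simp)
  simpa [I, integral_mul_const] using hconst

/-- `C²` solutions of `basisLaplacian b f = 0` on an open set are smooth. -/
lemma contDiffAt_of_basisLaplacian_eq_zero (b : Basis ι ℝ E) {f : E → ℝ} {U : Set E}
    (hU : IsOpen U) (hf : ContDiffOn ℝ 2 f U) (hL : ∀ x ∈ U, basisLaplacian b f x = 0)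
    {x : E} (hx : x ∈ U) : ContDiffAt ℝ ∞ f x := by
  let ν : Measure E := Measure.addHaar
  obtain ⟨R, hR, hRU⟩ := Metric.isOpen_iff.1 hU x hx
  let χ : ContDiffBump x := ⟨R / 2, 3 * R / 4, by positivity, by linarith⟩
  let w : E → ℝ := fun y => χ y * f y
  have hχsupp : tsupport χ ⊆ U := by
    rw [χ.tsupport_eq]
    exact (Metric.closedBall_subset_ball (by simp only [χ]; linarith)).trans hRU
  have hw : ContDiff ℝ 2 w := by
    rw [contDiff_iff_contDiffAt]
    intro y
    by_cases hy : y ∈ tsupport χ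
    · exact χ.contDiffAt.mul (hf.contDiffAt (hU.mem_nhds (hχsupp hy)))
    · have : w =ᶠ[𝓝 y] fun _ => 0 := by
        filter_upwards [notMem_tsupport_iff_eventuallyEq.1 hy] with z hz
        simp [w, hz]
      exact contDiffAt_const.congr_of_eventuallyEq this
  have hwc : HasCompactSupport w := χ.hasCompactSupport.mul_right
  have hwf : ∀ y ∈ Metric.ball x (R / 2), w =ᶠ[𝓝 y] f := fun y hy => by
    filter_upwards [Metric.isOpen_ball.mem_nhds hy] with z hz
    simp [w, χ.one_of_mem_closedBall (Metric.ball_subset_closedBall hz)]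
  have hLw : ∀ y ∈ Metric.ball x (R / 2), basisLaplacian b w y = 0 := fun y hy => by
    rw [basisLaplacian_congr b (hwf y hy)]
    exact hL y (hRU (Metric.ball_subset_ball (by linarith) hy))
  obtain ⟨φ, Ψ, hφ, hφc, hφ0, hφ00, hΨ, hΨc, hΨr, hΨφ⟩ :=
    exists_basisSq_kernel b (r := R / 4) (by positivity)
  have hpos : 0 < ∫ y, φ y ∂ν :=
    hφ.continuous.integral_pos_of_hasCompactSupport_nonneg_nonzero hφc hφ0 hφ00
  have hconv : ContDiff ℝ ∞ fun z => ∫ y, φ y * w (z - y) ∂ν :=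
    hφc.contDiff_convolution_left (ContinuousLinearMap.mul ℝ ℝ) hφ
      (hw.continuous.locallyIntegrable (μ := ν))
  have heq : f =ᶠ[𝓝 x] fun z => (∫ y, φ y ∂ν)⁻¹ * ∫ y, φ y * w (z - y) ∂ν := by
    filter_upwards [Metric.ball_mem_nhds x (show 0 < R / 4 by positivity)] with z hz
    rw [integral_mul_comp_sub_eq b hw hwc hφ.continuous hφc hΨ hΨc hΨφ z,
      inv_mul_cancel_left₀ hpos.ne']
    · exact (hwf z (Metric.ball_subset_ball (by linarith) hz)).eq_of_nhds.symm
    · intro y hy t ht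
      refine hLw _ ?_
      rw [Metric.mem_ball, dist_eq_norm] at hz ⊢
      have h1 : ‖t • y‖ ≤ ‖y‖ := by
        rw [norm_smul, Real.norm_eq_abs, abs_of_nonneg ht.1]
        exact mul_le_of_le_one_left (norm_nonneg _) ht.2
      calc ‖z - t • y - x‖ = ‖(z - x) - t • y‖ := by congr 1; abel
        _ ≤ ‖z - x‖ + ‖t • y‖ := norm_sub_le _ _
        _ < R / 2 := by linarith [hΨr y hy]
  exact (contDiff_const.mul hconv).contDiffAt.congr_of_eventuallyEq heq

/-- Energy argument: integrate the divergence of `W f ∇f` for a weight `W` that is a function of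
`basisSq b` supported away from the origin. -/
lemma fderiv_eq_zero_of_homogeneous_zero (b : Basis ι ℝ E) {f : E → ℝ}
    (hf : ContDiffOn ℝ 2 f {0}ᶜ)
    (hhom : ∀ t : ℝ, 0 < t → ∀ x : E, x ≠ 0 → f (t • x) = t ^ (0 : ℝ) * f x)
    (hL : ∀ x, x ≠ 0 → basisLaplacian b f x = 0) {x : E} (hx : x ≠ 0) : fderiv ℝ f x = 0 := by
  let ν : Measure E := Measure.addHaar
  have hfx : ∀ x, x ≠ 0 → ContDiffAt ℝ 2 f x := fun x hx =>
    hf.contDiffAt (isOpen_compl_singleton.mem_nhds hx)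
  let g : ContDiffBump (2 : ℝ) := ⟨1 / 2, 1, by norm_num, by norm_num⟩
  let W : E → ℝ := fun x => g (basisSq b x)
  have hW : ContDiff ℝ 1 W := g.contDiff.comp (contDiff_basisSq b)
  have hWc : HasCompactSupport W := by
    refine hasCompactSupport_comp_basisSq b (s := 3) fun t ht => g.zero_of_le_dist ?_
    rw [Real.dist_eq]
    exact (by linarith : (1 : ℝ) ≤ t - 2).trans (le_abs_self _)
  have hW0 : W =ᶠ[𝓝 0] fun _ => 0 := by
    have : ∀ᶠ y in 𝓝 (0 : E), basisSq b y < 1 :=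
      (contDiff_basisSq b (n := 0)).continuous.continuousAt.eventually_lt continuousAt_const
        (by simp)
    filter_upwards [this] with y hy
    refine g.zero_of_le_dist ?_
    rw [dist_comm, Real.dist_eq]
    exact (by linarith : (1 : ℝ) ≤ 2 - basisSq b y).trans (le_abs_self _)
  have hD : ∀ k x, x ≠ 0 → ContDiffAt ℝ 1 (fun y => fderiv ℝ f y (b k)) x := fun k x hx =>
    (hfx x hx).fderiv_apply_const (by norm_num) _
  let V : ι → E → ℝ := fun k y => W y * (f y * fderiv ℝ f y (b k))
  have hV0 : ∀ k, V k =ᶠ[𝓝 0] fun _ => 0 := fun k => by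
    filter_upwards [hW0] with y hy
    simp [V, hy]
  have hV : ∀ k, ContDiff ℝ 1 (V k) := fun k => by
    rw [contDiff_iff_contDiffAt]
    intro y
    by_cases hy : y = 0
    · exact contDiffAt_const.congr_of_eventuallyEq (hy ▸ hV0 k)
    · exact hW.contDiffAt.mul (((hfx y hy).of_le (by norm_num)).mul (hD k y hy))
  have hVc : ∀ k, HasCompactSupport (V k) := fun k => hWc.mul_right
  have hdiv : ∀ y, ∑ k, fderiv ℝ (V k) y (b k) = W y * ∑ k, (fderiv ℝ f y (b k)) ^ 2 := by
    intro y
    by_cases hy : y = 0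
    · subst hy
      simp [(hV0 _).fderiv_eq, hW0.eq_of_nhds]
    have hfd : DifferentiableAt ℝ f y := (hfx y hy).differentiableAt two_ne_zero
    have hterm : ∀ k, fderiv ℝ (V k) y (b k) =
        2 * deriv g (basisSq b y) * f y * (b.coord k y * fderiv ℝ f y (b k)) +
        (W y * (fderiv ℝ f y (b k)) ^ 2 +
        W y * f y * fderiv ℝ (fun z => fderiv ℝ f z (b k)) y (b k)) := by
      intro k
      have hDd := (hD k y hy).differentiableAt one_ne_zero
      have hWk : fderiv ℝ W y (b k) = deriv g (basisSq b y) * (2 * b.coord k y) :=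
        fderiv_comp_basisSq b
          ((g.contDiff (n := 1)).differentiable one_ne_zero _).hasDerivAt k
      have hWd : DifferentiableAt ℝ W y := hW.differentiable one_ne_zero y
      have hVk := (hWd.hasFDerivAt.mul (hfd.hasFDerivAt.mul hDd.hasFDerivAt)).fderiv
      refine (DFunLike.congr_fun hVk (b k)).trans ?_
      simp only [add_apply, smul_apply, smul_eq_mul, hWk, Pi.mul_apply]
      ring
    have hE := fderiv_self_of_homogeneous hhom hy hfd
    rw [fderiv_eq_sum_coord b f y y, zero_mul] at hE
    have hLy := hL y hy
    rw [basisLaplacian] at hLy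
    rw [Finset.sum_congr rfl fun k _ => hterm k, Finset.sum_add_distrib, Finset.sum_add_distrib,
      ← Finset.mul_sum, ← Finset.mul_sum, ← Finset.mul_sum, hE, hLy]
    ring
  have hcont : ∀ k, Continuous fun y => fderiv ℝ (V k) y (b k) := fun k =>
    ((hV k).continuous_fderiv one_ne_zero).clm_apply continuous_const
  have hdiv_int : ∫ y, W y * ∑ k, (fderiv ℝ f y (b k)) ^ 2 ∂ν = 0 := by
    simp_rw [← hdiv]
    rw [integral_finsetSum _ fun k _ =>
      (hcont k).integrable_of_hasCompactSupport ((hVc k).fderiv_apply ℝ (b k))]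
    exact Finset.sum_eq_zero fun k _ => integral_fderiv_eq_zero (hV k) (hVc k) (b k)
  have hScont : Continuous fun y => W y * ∑ k, (fderiv ℝ f y (b k)) ^ 2 := by
    simp_rw [← hdiv]
    exact continuous_finsetSum _ fun k _ => hcont k
  have hzero : ∀ y, W y * ∑ k, (fderiv ℝ f y (b k)) ^ 2 = 0 := by
    intro y
    by_contra hne
    exact (hScont.integral_pos_of_hasCompactSupport_nonneg_nonzero (μ := ν) hWc.mul_right
      (fun z => mul_nonneg g.nonneg (Finset.sum_nonneg fun _ _ => sq_nonneg _)) hne).ne' hdiv_int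
  have hq : 0 < basisSq b x := by
    obtain ⟨C, hC, h⟩ := exists_norm_sq_le_basisSq b
    have h1 : 0 < ‖x‖ ^ 2 := by positivity
    exact pos_of_mul_pos_right (h1.trans_le (h x)) hC.le
  set t := Real.sqrt (2 / basisSq b x) with ht
  have ht0 : 0 < t := Real.sqrt_pos.2 (by positivity)
  have hqt : basisSq b (t • x) = 2 := by
    rw [basisSq_smul, ht, Real.sq_sqrt (by positivity)]
    field_simp
  have hWt : W (t • x) = 1 := by
    refine g.one_of_mem_closedBall ?_
    rw [hqt]
    exact Metric.mem_closedBall_self g.rIn_pos.le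
  have h0 := hzero (t • x)
  rw [hWt, one_mul, Finset.sum_eq_zero_iff_of_nonneg fun _ _ => sq_nonneg _] at h0
  refine ContinuousLinearMap.coe_injective (b.ext fun k => ?_)
  have hk := h0 k (Finset.mem_univ k)
  rw [sq_eq_zero_iff, fderiv_smul_of_homogeneous hhom _ t ht0 x hx] at hk
  simpa using (mul_eq_zero.1 hk).resolve_left (Real.rpow_pos_of_pos ht0 _).ne'

lemma exists_eq_const_of_homogeneous_zero (b : Basis ι ℝ E) (hE : 1 < Module.rank ℝ E)
    {f : E → ℝ} (hf : ContDiffOn ℝ 2 f {0}ᶜ)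
    (hhom : ∀ t : ℝ, 0 < t → ∀ x : E, x ≠ 0 → f (t • x) = t ^ (0 : ℝ) * f x)
    (hL : ∀ x, x ≠ 0 → basisLaplacian b f x = 0) : ∃ c, ∀ x, x ≠ 0 → f x = c := by
  obtain ⟨c, hc⟩ := isOpen_compl_singleton.exists_is_const_of_fderiv_eq_zero (𝕜 := ℝ)
    (isConnected_compl_singleton_of_one_lt_rank hE 0).isPreconnected (hf.differentiableOn two_ne_zero)
    fun x hx => fderiv_eq_zero_of_homogeneous_zero b hf hhom hL hx
  exact ⟨c, fun x hx => hc x hx⟩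

end BasisLaplacian

section Euclidean

open Module
open scoped ContDiff Topology

/-- Induction on the degree: partial derivatives lower it, and Euler's identity recovers `f`. -/
lemma exists_isHomogeneous_eq_eval {n : ℕ} (hn : 2 ≤ n)
    (b : Basis (Fin n) ℝ (EuclideanSpace ℝ (Fin n))) (m : ℕ) :
    ∀ f : EuclideanSpace ℝ (Fin n) → ℝ, ContDiffOn ℝ ∞ f {0}ᶜ →
      (∀ t : ℝ, 0 < t → ∀ x : EuclideanSpace ℝ (Fin n), x ≠ 0 →
        f (t • x) = t ^ (m : ℝ) * f x) →
      (∀ x, x ≠ 0 → basisLaplacian b f x = 0) →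
      ∃ p : MvPolynomial (Fin n) ℝ, p.IsHomogeneous m ∧
        ∀ x : EuclideanSpace ℝ (Fin n), x ≠ 0 → f x = MvPolynomial.eval (fun i => x i) p := by
  induction m with
  | zero =>
    intro f hf hhom hL
    have hrank : 1 < Module.rank ℝ (EuclideanSpace ℝ (Fin n)) := by
      rw [← finrank_eq_rank, finrank_euclideanSpace_fin]
      exact_mod_cast hn
    obtain ⟨c, hc⟩ := exists_eq_const_of_homogeneous_zero b hrank
      (hf.of_le (WithTop.coe_le_coe.2 le_top)) (by simpa using hhom) hL
    exact ⟨MvPolynomial.C c, MvPolynomial.isHomogeneous_C _ _, fun x hx => by simp [hc x hx]⟩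
  | succ m ih =>
    intro f hf hhom hL
    have hfx : ∀ x, x ≠ 0 → ContDiffAt ℝ ∞ f x := fun x hx =>
      hf.contDiffAt (isOpen_compl_singleton.mem_nhds hx)
    have key : ∀ i : Fin n, ∃ p : MvPolynomial (Fin n) ℝ, p.IsHomogeneous m ∧
        ∀ x : EuclideanSpace ℝ (Fin n), x ≠ 0 →
          fderiv ℝ f x (PiLp.basisFun 2 ℝ (Fin n) i) = MvPolynomial.eval (fun i => x i) p := by
      intro i
      refine ih _ (fun x hx => ?_) ?_ fun x hx => ?_
      · exact ((hfx x hx).fderiv_apply_const (m := ∞) (by simp) _).contDiffWithinAt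
      · have h := fderiv_smul_of_homogeneous hhom (PiLp.basisFun 2 ℝ (Fin n) i)
        rwa [Nat.cast_succ, add_sub_cancel_right] at h
      · rw [basisLaplacian_fderiv b ((hfx x hx).of_le
          (WithTop.coe_le_coe.2 le_top))]
        have : basisLaplacian b f =ᶠ[𝓝 x] fun _ => 0 := by
          filter_upwards [isOpen_compl_singleton.mem_nhds hx] with y hy using hL y hy
        simp [this.fderiv_eq]
    choose p hp hpe using key
    refine ⟨MvPolynomial.C ((m + 1 : ℝ)⁻¹) * ∑ i, MvPolynomial.X i * p i, ?_, fun x hx => ?_⟩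
    · rw [← zero_add (m + 1)]
      refine (MvPolynomial.isHomogeneous_C _ _).mul (.sum _ _ _ fun i _ => ?_)
      rw [add_comm]
      exact (MvPolynomial.isHomogeneous_X _ i).mul (hp i)
    · have hE := fderiv_self_of_homogeneous hhom hx ((hfx x hx).differentiableAt (by simp))
      rw [fderiv_eq_sum_coord (PiLp.basisFun 2 ℝ (Fin n)) f x x] at hE
      have hm : (m + 1 : ℝ) ≠ 0 := by positivity
      simp only [map_mul, MvPolynomial.eval_C, map_sum, MvPolynomial.eval_X, ← hpe _ x hx]
      rw [eq_inv_mul_iff_mul_eq₀ hm]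
      simpa using hE.symm

open scoped MatrixOrder in
lemma exists_basis_of_forall_posSemidef {n : ℕ} (l : Matrix (Fin n) (Fin n) ℝ →ₗ[ℝ] ℝ)
    (hl : ∀ P : Matrix (Fin n) (Fin n) ℝ, P.PosSemidef → P ≠ 0 → 0 < l P) :
    ∃ b : Basis (Fin n) ℝ (EuclideanSpace ℝ (Fin n)),
      ∀ S : Matrix (Fin n) (Fin n) ℝ, S.IsSymm →
        l S = ∑ k, ∑ i, ∑ j, b k i * b k j * S i j := by
  let A : Matrix (Fin n) (Fin n) ℝ := Matrix.of fun i j =>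
    (l (Matrix.single i j 1) + l (Matrix.single j i 1)) / 2
  have hlS : ∀ S : Matrix (Fin n) (Fin n) ℝ,
      l S = ∑ i, ∑ j, S i j * l (Matrix.single i j 1) := by
    intro S
    conv_lhs => rw [Matrix.matrix_eq_sum_single S]
    simp only [map_sum]
    refine Finset.sum_congr rfl fun i _ => Finset.sum_congr rfl fun j _ => ?_
    rw [← smul_eq_mul, ← map_smul, Matrix.smul_single, smul_eq_mul, mul_one]
  have hlA : ∀ S : Matrix (Fin n) (Fin n) ℝ, S.IsSymm → l S = ∑ i, ∑ j, S i j * A i j := by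
    intro S hS
    have h2 : l S = ∑ i, ∑ j, S i j * l (Matrix.single j i 1) := by
      rw [hlS, Finset.sum_comm]
      simp only [hS.apply]
    have h3 : l S = (l S + l S) / 2 := by ring
    rw [h3]
    nth_rewrite 1 [hlS S]
    rw [h2, ← Finset.sum_add_distrib, Finset.sum_div]
    refine Finset.sum_congr rfl fun i _ => ?_
    rw [← Finset.sum_add_distrib, Finset.sum_div]
    refine Finset.sum_congr rfl fun j _ => ?_
    simp only [A, Matrix.of_apply]
    ring
  have hA : A.PosDef := by
    refine Matrix.PosDef.of_dotProduct_mulVec_pos ?_ fun x hx => ?_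
    · ext i j
      simp [A, add_comm]
    · have hpos := hl (Matrix.vecMulVec x (star x)) (Matrix.posSemidef_vecMulVec_self_star x)
        (by simpa [Matrix.vecMulVec_eq_zero] using hx)
      rw [hlA _ (by ext i j; simp [Matrix.vecMulVec_apply, mul_comm])] at hpos
      refine hpos.trans_eq ?_
      simp only [dotProduct, Matrix.mulVec, Matrix.vecMulVec_apply, Finset.mul_sum]
      refine Finset.sum_congr rfl fun i _ => Finset.sum_congr rfl fun j _ => ?_
      simp
      ring
  obtain ⟨B, hB, hAB⟩ := CStarAlgebra.isStrictlyPositive_iff_eq_star_mul_self.mp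
    hA.isStrictlyPositive
  let b₀ : Basis (Fin n) ℝ (Fin n → ℝ) := basisOfLinearIndependentOfCardEqFinrank'
    B.row (Matrix.linearIndependent_rows_iff_isUnit.2 hB) (by simp)
  refine ⟨b₀.map (WithLp.linearEquiv 2 ℝ (Fin n → ℝ)).symm, fun S hS => ?_⟩
  have hb : ∀ k i, (b₀.map (WithLp.linearEquiv 2 ℝ (Fin n → ℝ)).symm) k i = B k i := by
    intro k i
    simp [b₀]
  simp only [hb]
  rw [hlA S hS]
  symm
  rw [Finset.sum_comm]
  refine Finset.sum_congr rfl fun i _ => ?_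
  rw [Finset.sum_comm]
  refine Finset.sum_congr rfl fun j _ => ?_
  rw [hAB, Matrix.mul_apply, Finset.mul_sum]
  refine Finset.sum_congr rfl fun k _ => ?_
  simp only [star_trivial, Matrix.star_apply]
  ring

lemma ContDiffAt.isSymm_hessian {n : ℕ} {u : EuclideanSpace ℝ (Fin n) → ℝ}
    {x : EuclideanSpace ℝ (Fin n)} (h : ContDiffAt ℝ 2 u x) : (hessian u x).IsSymm := by
  ext i j
  exact fderiv_fderiv_comm h _ _

lemma fderiv_fderiv_eq_sum_hessian {n : ℕ} {u : EuclideanSpace ℝ (Fin n) → ℝ}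
    {x : EuclideanSpace ℝ (Fin n)} (h : ContDiffAt ℝ 2 u x) (v : EuclideanSpace ℝ (Fin n)) :
    fderiv ℝ (fun y => fderiv ℝ u y v) x v = ∑ i, ∑ j, v i * v j * hessian u x i j := by
  have hd : ∀ j, DifferentiableAt ℝ
      (fun y => fderiv ℝ u y (EuclideanSpace.single j (1 : ℝ))) x := fun j =>
    (h.fderiv_apply_const (m := 1) (by norm_num) _).differentiableAt one_ne_zero
  have h1 : (fun y => fderiv ℝ u y v) =
      fun y => ∑ j, v j * fderiv ℝ u y (EuclideanSpace.single j (1 : ℝ)) := by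
    funext y
    simpa using fderiv_eq_sum_coord (PiLp.basisFun 2 ℝ (Fin n)) u y v
  rw [fderiv_eq_sum_coord (PiLp.basisFun 2 ℝ (Fin n)) _ x v]
  refine Finset.sum_congr rfl fun i _ => ?_
  rw [h1, fderiv_fun_sum fun j _ => (hd j).const_mul _, sum_apply, Finset.mul_sum]
  refine Finset.sum_congr rfl fun j _ => ?_
  rw [fderiv_const_mul (hd j)]
  simp [hessian]
  ring

lemma hessian_congr {n : ℕ} {u v : EuclideanSpace ℝ (Fin n) → ℝ} {x : EuclideanSpace ℝ (Fin n)}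
    (h : u =ᶠ[𝓝 x] v) : hessian u x = hessian v x := by
  ext i j
  have : (fun y => fderiv ℝ u y (EuclideanSpace.single j (1 : ℝ))) =ᶠ[𝓝 x]
      fun y => fderiv ℝ v y (EuclideanSpace.single j (1 : ℝ)) := by
    filter_upwards [h.fderiv (𝕜 := ℝ)] with y hy
    rw [hy]
  simp only [hessian, Matrix.of_apply, this.fderiv_eq]

lemma continuous_hessian {n : ℕ} {u : EuclideanSpace ℝ (Fin n) → ℝ} (hu : ContDiff ℝ 2 u) :
    Continuous (hessian u) := by
  refine continuous_matrix fun i j => ?_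
  have : ContDiff ℝ 1 fun y => fderiv ℝ u y (EuclideanSpace.single j (1 : ℝ)) :=
    (hu.fderiv_right (m := 1) (by norm_num)).clm_apply contDiff_const
  exact (this.continuous_fderiv one_ne_zero).clm_apply continuous_const

lemma hessian_smul_of_homogeneous {n : ℕ} {u : EuclideanSpace ℝ (Fin n) → ℝ} {a : ℝ}
    (h : ∀ t : ℝ, 0 < t → ∀ x : EuclideanSpace ℝ (Fin n), x ≠ 0 → u (t • x) = t ^ a * u x)
    {t : ℝ} (ht : 0 < t) {x : EuclideanSpace ℝ (Fin n)} (hx : x ≠ 0) :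
    hessian u (t • x) = t ^ (a - 2) • hessian u x := by
  ext i j
  have := fderiv_smul_of_homogeneous (f := fun y => fderiv ℝ u y (EuclideanSpace.single j (1 : ℝ)))
    (fderiv_smul_of_homogeneous h (EuclideanSpace.single j (1 : ℝ)))
    (EuclideanSpace.single i (1 : ℝ)) t ht x hx
  rw [show a - 1 - 1 = a - 2 by ring] at this
  simpa [hessian] using this

lemma fderiv_zero_apply_eq_zero_of_ray {V : Type*} [NormedAddCommGroup V] [NormedSpace ℝ V]
    {F : V → ℝ} (hF : ContDiff ℝ 1 F) {M : V} (h : ∀ s : ℝ, 0 < s → F (s • M) = 0) :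
    fderiv ℝ F 0 M = 0 := by
  have hs : ∀ s : ℝ, 0 < s → fderiv ℝ F (s • M) M = 0 := by
    intro s hs
    have h1 : HasDerivAt (fun s : ℝ => F (s • M)) (fderiv ℝ F (s • M) M) s := by
      have h2 : HasDerivAt (fun s : ℝ => s • M) M s := by
        simpa using (hasDerivAt_id s).smul_const M
      exact (hF.differentiable one_ne_zero _).hasFDerivAt.comp_hasDerivAt s h2
    refine h1.unique ((hasDerivAt_const s (0 : ℝ)).congr_of_eventuallyEq ?_)
    filter_upwards [lt_mem_nhds hs] with r hr using h r hr
  have hc : Continuous fun s : ℝ => fderiv ℝ F (s • M) M :=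
    ((hF.continuous_fderiv one_ne_zero).comp (by fun_prop)).clm_apply continuous_const
  have hlim := (hc.tendsto 0).mono_left (nhdsWithin_le_nhds (s := Set.Ioi 0))
  rw [zero_smul] at hlim
  refine tendsto_nhds_unique hlim (tendsto_const_nhds.congr' ?_)
  filter_upwards [self_mem_nhdsWithin] with s hs' using (hs s hs').symm

end Euclidean

theorem stmt2 {n : ℕ} (hn : 2 ≤ n) (μ : ℝ) (hμ : 0 < μ) (hμ1 : μ ≤ 1)
    (m : ℕ) (hm : m ≠ 2)
    (F : Matrix (Fin n) (Fin n) ℝ → ℝ)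
    (hF : ContDiff ℝ 1 F)
    (hFell : ∀ M : Matrix (Fin n) (Fin n) ℝ, M.IsSymm →
      ∀ P : Matrix (Fin n) (Fin n) ℝ, P.IsSymm → P.PosSemidef →
        μ * P.trace ≤ fderiv ℝ F M P ∧ fderiv ℝ F M P ≤ μ⁻¹ * P.trace)
    (u : EuclideanSpace ℝ (Fin n) → ℝ)
    (hu : ContDiffOn ℝ 2 u {(0 : EuclideanSpace ℝ (Fin n))}ᶜ)
    (hhom : ∀ t : ℝ, 0 < t → ∀ x : EuclideanSpace ℝ (Fin n), x ≠ 0 →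
      u (t • x) = t ^ (m : ℝ) * u x)
    (hsol : ∀ x : EuclideanSpace ℝ (Fin n), x ≠ 0 → F (hessian u x) = 0) :
    ∃ p : MvPolynomial (Fin n) ℝ, p.IsHomogeneous m ∧
      (∀ x : EuclideanSpace ℝ (Fin n), x ≠ 0 →
        u x = MvPolynomial.eval (fun i => x i) p) ∧
      (∀ x : EuclideanSpace ℝ (Fin n),
        fderiv ℝ F 0
          (hessian (fun y => MvPolynomial.eval (fun i => y i) p) x) = 0) := by
  have hux : ∀ x, x ≠ 0 → ContDiffAt ℝ 2 u x := fun x hx =>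
    hu.contDiffAt (isOpen_compl_singleton.mem_nhds hx)
  have hell : ∀ P : Matrix (Fin n) (Fin n) ℝ, P.PosSemidef → P ≠ 0 →
      0 < (fderiv ℝ F 0 : Matrix (Fin n) (Fin n) ℝ →ₗ[ℝ] ℝ) P := fun P hP hP0 =>
    (mul_pos hμ (hP.trace_nonneg.lt_of_ne fun h => hP0 (hP.trace_eq_zero_iff.1 h.symm))).trans_le
      (hFell 0 Matrix.isSymm_zero P hP.isHermitian hP).1
  obtain ⟨b, hb⟩ := exists_basis_of_forall_posSemidef _ hell
  have hlin : ∀ x, x ≠ 0 → fderiv ℝ F 0 (hessian u x) = 0 := by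
    intro x hx
    refine fderiv_zero_apply_eq_zero_of_ray hF fun s hs => ?_
    have hm' : (m : ℝ) - 2 ≠ 0 := sub_ne_zero.2 (by exact_mod_cast hm)
    have ht : 0 < s ^ ((m : ℝ) - 2)⁻¹ := Real.rpow_pos_of_pos hs _
    have h := hsol _ (smul_ne_zero ht.ne' hx)
    rwa [hessian_smul_of_homogeneous hhom ht hx, Real.rpow_inv_rpow hs.le hm'] at h
  have hL : ∀ x, x ≠ 0 → basisLaplacian b u x = 0 := by
    intro x hx
    rw [← hlin x hx]
    refine Eq.trans ?_ (hb _ (hux x hx).isSymm_hessian).symm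
    exact Finset.sum_congr rfl fun k _ => fderiv_fderiv_eq_sum_hessian (hux x hx) (b k)
  have hsmooth : ContDiffOn ℝ (⊤ : ℕ∞) u {0}ᶜ := fun x hx =>
    (contDiffAt_of_basisLaplacian_eq_zero b isOpen_compl_singleton hu hL hx).contDiffWithinAt
  obtain ⟨p, hp, hpu⟩ := exists_isHomogeneous_eq_eval hn b m u hsmooth hhom hL
  refine ⟨p, hp, hpu, fun x => ?_⟩
  have hpc : ContDiff ℝ 2
      fun y : EuclideanSpace ℝ (Fin n) => MvPolynomial.eval (fun i => y i) p := by
    simp_rw [MvPolynomial.eval_eq']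
    fun_prop
  have : Nontrivial (EuclideanSpace ℝ (Fin n)) :=
    Module.nontrivial_of_finrank_pos (R := ℝ) (by rw [finrank_euclideanSpace_fin]; omega)
  have hcl : IsClosed {x | fderiv ℝ F 0
      (hessian (fun y => MvPolynomial.eval (fun i => y i) p) x) = 0} :=
    isClosed_eq ((fderiv ℝ F 0).continuous.comp (continuous_hessian hpc)) continuous_const
  have hsub : ({0}ᶜ : Set (EuclideanSpace ℝ (Fin n))) ⊆ {x | fderiv ℝ F 0
      (hessian (fun y => MvPolynomial.eval (fun i => y i) p) x) = 0} := by
    intro y hy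
    have he : u =ᶠ[nhds y] fun z => MvPolynomial.eval (fun i => z i) p := by
      filter_upwards [isOpen_compl_singleton.mem_nhds hy] with z hz using hpu z hz
    rw [Set.mem_ofPred_eq, ← hessian_congr he]
    exact hlin y hy
  exact hcl.closure_subset_iff.2 hsub (dense_compl_singleton 0 x)
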